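/- Fix 1 < p < ∞ and let p′ = p/(p−1). For every measurable f : (0,∞) → ℝ, one has S|f| ∈ L^{p,1}(0,∞) (i.e. ∫₀^∞ λ_{S|f|}(s)^{1/p} ds < ∞) if and only if ∫₀^∞ |f(t)|·t^{−1/p′} dt < ∞. That is, the optimal domain [S, L^{p,1}] equals the weighted space L¹(t^{−1/p′} dt). -/

import Mathlib

open MeasureTheory Set
open scoped ENNReal

/-- The Hardy operator `S f (x) = (1/x) ∫₀ˣ f(y) dy`. -/
noncomputable def S (f : ℝ → ℝ) (x : ℝ) : ℝ := (1 / x) * ∫ y in Ioo (0 : ℝ) x, f y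

/-- The distribution function `λ_g(s) = |{x ∈ (0,∞) : |g(x)| > s}|`. -/
noncomputable def distFn (g : ℝ → ℝ) (s : ℝ) : ℝ≥0∞ :=
  volume {x | x ∈ Ioi (0 : ℝ) ∧ s < |g x|}

/-- The measure `t^(a-1) dt` on `(0,∞)`. -/
noncomputable def powMeasure (a : ℝ) : Measure ℝ :=
  (volume.restrict (Ioi (0 : ℝ))).withDensity fun t => ENNReal.ofReal (t ^ (a - 1))

lemma measurable_ofReal_rpow (b : ℝ) : Measurable fun t : ℝ => ENNReal.ofReal (t ^ b) :=
  (measurable_id.pow_const b).ennreal_ofReal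

lemma powMeasure_apply (a : ℝ) {E : Set ℝ} (hE : MeasurableSet E) (hpos : E ⊆ Ioi 0) :
    powMeasure a E = ∫⁻ t in E, ENNReal.ofReal (t ^ (a - 1)) := by
  rw [powMeasure, withDensity_apply _ hE, Measure.restrict_restrict hE,
    inter_eq_left.mpr hpos]

lemma lintegral_powMeasure (a : ℝ) {g : ℝ → ℝ≥0∞} (hg : Measurable g) :
    ∫⁻ t, g t ∂powMeasure a = ∫⁻ t in Ioi (0 : ℝ), ENNReal.ofReal (t ^ (a - 1)) * g t :=
  lintegral_withDensity_eq_lintegral_mul _ (measurable_ofReal_rpow _) hg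

lemma ae_powMeasure_pos (a : ℝ) : ∀ᵐ t ∂powMeasure a, 0 < t :=
  (withDensity_absolutelyContinuous _ _).ae_le (ae_restrict_mem measurableSet_Ioi)

lemma powMeasure_inter_Ioi (a : ℝ) (E : Set ℝ) :
    powMeasure a (Ioi 0 ∩ E) = powMeasure a E := by
  refine measure_congr ?_
  filter_upwards [ae_powMeasure_pos a] with t ht
  exact propext ⟨fun h => h.2, fun h => ⟨ht, h⟩⟩

lemma powMeasure_Ioc {a : ℝ} (ha : 0 < a) {x y : ℝ} (hx : 0 ≤ x) (hxy : x ≤ y) :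
    powMeasure a (Ioc x y) = ENNReal.ofReal ((y ^ a - x ^ a) / a) := by
  have hpos : Ioc x y ⊆ Ioi 0 := fun t ht => hx.trans_lt ht.1
  have hint : IntegrableOn (fun t : ℝ => t ^ (a - 1)) (Ioc x y) :=
    (intervalIntegrable_iff_integrableOn_Ioc_of_le hxy).1
      (intervalIntegral.intervalIntegrable_rpow' (by linarith))
  rw [powMeasure_apply a measurableSet_Ioc hpos, ← ofReal_integral_eq_lintegral_ofReal hint,
    ← intervalIntegral.integral_of_le hxy, integral_rpow (Or.inl (by linarith)), sub_add_cancel]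
  filter_upwards [ae_restrict_mem measurableSet_Ioc] with t ht
  exact Real.rpow_nonneg (hpos ht).le _

/-- Among sets of given Lebesgue measure, `powMeasure a` is largest on initial intervals,
up to a constant. -/
lemma powMeasure_le_volume_rpow {a : ℝ} (ha : 0 < a) (ha1 : a < 1) {E : Set ℝ}
    (hE : MeasurableSet E) (hpos : E ⊆ Ioi 0) :
    powMeasure a E ≤ ENNReal.ofReal (1 / a + 1) * volume E ^ a := by
  have hC : 0 < 1 / a + 1 := by positivity
  rcases eq_or_ne (volume E) ⊤ with htop | htop
  · rw [htop, ENNReal.top_rpow_of_pos ha, ENNReal.mul_top (by simpa using hC)]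
    exact le_top
  rcases eq_or_ne (volume E) 0 with hzero | hzero
  · rw [powMeasure_apply a hE hpos, setLIntegral_measure_zero _ _ hzero]
    exact zero_le
  obtain ⟨m, hm⟩ : ∃ m, m = (volume E).toReal := ⟨_, rfl⟩
  have hm0 : 0 < m := hm ▸ ENNReal.toReal_pos hzero htop
  have hvol : volume E = ENNReal.ofReal m := by rw [hm, ENNReal.ofReal_toReal htop]
  have hfar : powMeasure a (E \ Ioc 0 m) ≤ ENNReal.ofReal (m ^ a) := by
    rw [powMeasure_apply a (hE.diff measurableSet_Ioc) (sdiff_subset.trans hpos)]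
    calc ∫⁻ t in E \ Ioc 0 m, ENNReal.ofReal (t ^ (a - 1))
        ≤ ∫⁻ _ in E \ Ioc 0 m, ENNReal.ofReal (m ^ (a - 1)) := by
          refine setLIntegral_mono measurable_const fun t ht => ENNReal.ofReal_le_ofReal ?_
          have hmt : m < t := not_le.1 fun h => ht.2 ⟨hpos ht.1, h⟩
          exact Real.rpow_le_rpow_of_nonpos hm0 hmt.le (by linarith)
      _ ≤ ENNReal.ofReal (m ^ (a - 1)) * ENNReal.ofReal m := by
          rw [setLIntegral_const, ← hvol]
          gcongr
          exact sdiff_subset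
      _ = ENNReal.ofReal (m ^ a) := by
          rw [← ENNReal.ofReal_mul (by positivity), ← Real.rpow_add_one hm0.ne', sub_add_cancel]
  calc powMeasure a E ≤ powMeasure a (Ioc 0 m) + powMeasure a (E \ Ioc 0 m) :=
        (measure_mono (by rw [union_sdiff_self]; exact subset_union_right)).trans
          (measure_union_le _ _)
    _ ≤ ENNReal.ofReal (m ^ a / a) + ENNReal.ofReal (m ^ a) := by
        rw [powMeasure_Ioc ha le_rfl hm0.le, Real.zero_rpow ha.ne', sub_zero]
        gcongr
    _ = ENNReal.ofReal (1 / a + 1) * volume E ^ a := by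
        rw [hvol, ENNReal.ofReal_rpow_of_pos hm0, ← ENNReal.ofReal_mul hC.le,
          ← ENNReal.ofReal_add (by positivity) (by positivity)]
        congr 1
        ring

/-- If `(x, 2x] ⊆ B` for every `x ∈ A`, then `A` is controlled by the `powMeasure` of `B`. -/
lemma volume_rpow_le_powMeasure {a : ℝ} (ha : 0 < a) {A B : Set ℝ} (hpos : A ⊆ Ioi 0)
    (hAB : ∀ x ∈ A, Ioc x (2 * x) ⊆ B) :
    volume A ^ a ≤ ENNReal.ofReal (a / (2 ^ a - 1)) * powMeasure a B := by
  have h2 : (0 : ℝ) < 2 ^ a - 1 := sub_pos.2 (Real.one_lt_rpow one_lt_two ha)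
  obtain ⟨K, hK⟩ : ∃ K, K = ENNReal.ofReal (a / (2 ^ a - 1)) * powMeasure a B := ⟨_, rfl⟩
  rw [← hK]
  rcases eq_or_ne K ⊤ with htop | htop
  · simp [htop]
  have hle : ∀ x ∈ A, x ^ a ≤ K.toReal := by
    intro x hx
    have hx0 : 0 < x := hpos hx
    rw [← ENNReal.ofReal_le_iff_le_toReal htop, hK]
    calc ENNReal.ofReal (x ^ a)
        = ENNReal.ofReal (a / (2 ^ a - 1)) * powMeasure a (Ioc x (2 * x)) := by
          rw [powMeasure_Ioc ha hx0.le (by linarith), ← ENNReal.ofReal_mul (by positivity),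
            Real.mul_rpow zero_le_two hx0.le]
          congr 1
          field_simp
      _ ≤ _ := by gcongr; exact hAB x hx
  have hsub : A ⊆ Ioc 0 (K.toReal ^ a⁻¹) := fun x hx =>
    ⟨hpos hx, (Real.le_rpow_inv_iff_of_pos (hpos hx).le ENNReal.toReal_nonneg ha).2 (hle x hx)⟩
  calc volume A ^ a ≤ (ENNReal.ofReal (K.toReal ^ a⁻¹)) ^ a := by
        gcongr
        exact (measure_mono hsub).trans (by rw [Real.volume_Ioc, sub_zero])
    _ = K := by
        rw [ENNReal.ofReal_rpow_of_nonneg (by positivity) ha.le,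
          Real.rpow_inv_rpow ENNReal.toReal_nonneg ha.ne', ENNReal.ofReal_toReal htop]

lemma lintegral_Ioi_rpow {a : ℝ} (ha1 : a < 1) {y : ℝ} (hy : 0 < y) :
    ∫⁻ x in Ioi y, ENNReal.ofReal (x ^ (a - 2)) =
      ENNReal.ofReal (1 / (1 - a)) * ENNReal.ofReal (y ^ (a - 1)) := by
  rw [← ofReal_integral_eq_lintegral_ofReal (integrableOn_Ioi_rpow_of_lt (by linarith) hy),
    integral_Ioi_rpow_of_lt (by linarith) hy, ← ENNReal.ofReal_mul (by
      rw [one_div_nonneg]; linarith)]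
  · congr 1
    rw [show a - 2 + 1 = a - 1 by ring, ← neg_sub 1 a, neg_div_neg_eq]
    ring
  · filter_upwards [ae_restrict_mem measurableSet_Ioi] with t ht
    exact Real.rpow_nonneg (hy.trans ht).le _

section Hardy

variable {f : ℝ → ℝ}

lemma monotone_setIntegral_Ioo_abs (hfloc : ∀ x > (0 : ℝ), IntegrableOn f (Ioo 0 x)) :
    Monotone fun x => ∫ y in Ioo (0 : ℝ) x, |f y| := by
  intro x z hxz
  rcases le_or_gt z 0 with hz | hz
  · simp [Ioo_eq_empty (not_lt.2 hz), Ioo_eq_empty (not_lt.2 (hxz.trans hz))]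
  · exact setIntegral_mono_set (hfloc z hz).abs (ae_of_all _ fun y => abs_nonneg _)
      (Ioo_subset_Ioo_right hxz).eventuallyLE

lemma S_abs_nonneg {x : ℝ} (hx : 0 < x) : 0 ≤ S (fun y => |f y|) x :=
  mul_nonneg (by positivity) (integral_nonneg fun y => abs_nonneg _)

lemma measurable_S_abs (hfloc : ∀ x > (0 : ℝ), IntegrableOn f (Ioo 0 x)) :
    Measurable (S fun y => |f y|) :=
  (measurable_const.div measurable_id).mul (monotone_setIntegral_Ioo_abs hfloc).measurable

lemma S_abs_le_two_mul (hfloc : ∀ x > (0 : ℝ), IntegrableOn f (Ioo 0 x)) {x t : ℝ}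
    (hx : 0 < x) (ht : t ∈ Ioc x (2 * x)) :
    S (fun y => |f y|) x ≤ 2 * S (fun y => |f y|) t := by
  have ht0 : 0 < t := hx.trans ht.1
  have hmono := monotone_setIntegral_Ioo_abs hfloc ht.1.le
  have hnonneg : 0 ≤ ∫ y in Ioo (0 : ℝ) x, |f y| := integral_nonneg fun y => abs_nonneg _
  have hinv : 1 / x ≤ 2 * (1 / t) := by
    rw [mul_one_div, div_le_div_iff₀ hx ht0]
    linarith [ht.2]
  calc S (fun y => |f y|) x ≤ (2 * (1 / t)) * ∫ y in Ioo (0 : ℝ) t, |f y| :=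
        mul_le_mul hinv hmono hnonneg (by positivity)
    _ = 2 * S (fun y => |f y|) t := by rw [S, mul_assoc]

lemma distFn_S_abs (s : ℝ) :
    distFn (S fun y => |f y|) s = volume (Ioi 0 ∩ {x | s < S (fun y => |f y|) x}) := by
  rw [distFn]
  congr 1
  ext x
  exact and_congr_right fun hx => by rw [abs_of_nonneg (S_abs_nonneg hx)]; rfl

lemma lintegral_S_abs_powMeasure {a : ℝ} (ha1 : a < 1) (hfmeas : Measurable f)
    (hfloc : ∀ x > (0 : ℝ), IntegrableOn f (Ioo 0 x)) :
    ∫⁻ x, ENNReal.ofReal (S (fun y => |f y|) x) ∂powMeasure a =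
      ENNReal.ofReal (1 / (1 - a)) *
        ∫⁻ t in Ioi (0 : ℝ), ENNReal.ofReal (|f t| * t ^ (a - 1)) := by
  have hfabs : Measurable fun y => ENNReal.ofReal |f y| := hfmeas.abs.ennreal_ofReal
  have hkernel : Measurable (Function.uncurry fun x y : ℝ =>
      {q : ℝ × ℝ | q.2 < q.1}.indicator
        (fun q => ENNReal.ofReal (q.1 ^ (a - 2)) * ENNReal.ofReal |f q.2|) (x, y)) :=
    (((measurable_ofReal_rpow _).comp measurable_fst).mul (hfabs.comp measurable_snd)).indicator
      (measurableSet_lt measurable_snd measurable_fst)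
  calc ∫⁻ x, ENNReal.ofReal (S (fun y => |f y|) x) ∂powMeasure a
      = ∫⁻ x in Ioi (0 : ℝ), ∫⁻ y in Ioi (0 : ℝ), {q : ℝ × ℝ | q.2 < q.1}.indicator
          (fun q => ENNReal.ofReal (q.1 ^ (a - 2)) * ENNReal.ofReal |f q.2|) (x, y) := by
        rw [lintegral_powMeasure a (measurable_S_abs hfloc).ennreal_ofReal]
        refine setLIntegral_congr_fun measurableSet_Ioi fun x hx => ?_
        have hx0 : 0 < x := hx
        have hslice : (fun y => {q : ℝ × ℝ | q.2 < q.1}.indicator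
            (fun q => ENNReal.ofReal (q.1 ^ (a - 2)) * ENNReal.ofReal |f q.2|) (x, y)) =
            (Iio x).indicator
              (fun y => ENNReal.ofReal (x ^ (a - 2)) * ENNReal.ofReal |f y|) := rfl
        simp only [hslice]
        rw [setLIntegral_indicator measurableSet_Iio, Iio_inter_Ioi,
          lintegral_const_mul _ hfabs, S, ENNReal.ofReal_mul (by positivity),
          ofReal_integral_eq_lintegral_ofReal (hfloc x hx0).abs
            (ae_of_all _ fun y => abs_nonneg _), ← mul_assoc,
          ← ENNReal.ofReal_mul (by positivity)]
        congr 2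
        rw [show a - 2 = a - 1 - 1 by ring, Real.rpow_sub_one hx0.ne' (a - 1), mul_one_div]
    _ = ∫⁻ y in Ioi (0 : ℝ), ∫⁻ x in Ioi (0 : ℝ), {q : ℝ × ℝ | q.2 < q.1}.indicator
          (fun q => ENNReal.ofReal (q.1 ^ (a - 2)) * ENNReal.ofReal |f q.2|) (x, y) :=
        lintegral_lintegral_swap hkernel.aemeasurable
    _ = _ := by
        rw [← lintegral_const_mul' _ _ ENNReal.ofReal_ne_top]
        refine setLIntegral_congr_fun measurableSet_Ioi fun y hy => ?_
        have hslice : (fun x => {q : ℝ × ℝ | q.2 < q.1}.indicator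
            (fun q => ENNReal.ofReal (q.1 ^ (a - 2)) * ENNReal.ofReal |f q.2|) (x, y)) =
            (Ioi y).indicator
              (fun x => ENNReal.ofReal (x ^ (a - 2)) * ENNReal.ofReal |f y|) := rfl
        simp only [hslice]
        rw [setLIntegral_indicator measurableSet_Ioi,
          inter_eq_left.2 (Ioi_subset_Ioi (le_of_lt hy)),
          lintegral_mul_const _ (measurable_ofReal_rpow _), lintegral_Ioi_rpow ha1 hy,
          ENNReal.ofReal_mul (abs_nonneg _)]
        ring

/-- Layer cake representation against `powMeasure`. -/
lemma lintegral_const_mul_S_abs_powMeasure (a : ℝ) {c : ℝ} (hc : 0 ≤ c)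
    (hfloc : ∀ x > (0 : ℝ), IntegrableOn f (Ioo 0 x)) :
    ENNReal.ofReal c * ∫⁻ x, ENNReal.ofReal (S (fun y => |f y|) x) ∂powMeasure a =
      ∫⁻ s in Ioi (0 : ℝ), powMeasure a {x | s < c * S (fun y => |f y|) x} := by
  rw [← lintegral_eq_lintegral_meas_lt, ← lintegral_const_mul _
    (measurable_S_abs hfloc).ennreal_ofReal]
  · simp only [ENNReal.ofReal_mul hc]
  · filter_upwards [ae_powMeasure_pos a] with x hx
    exact mul_nonneg hc (S_abs_nonneg hx)
  · exact ((measurable_S_abs hfloc).const_mul c).aemeasurable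

lemma lintegral_distFn_S_abs_le {a : ℝ} (ha : 0 < a)
    (hfloc : ∀ x > (0 : ℝ), IntegrableOn f (Ioo 0 x)) :
    ∫⁻ s in Ioi (0 : ℝ), distFn (S fun y => |f y|) s ^ a ≤
      ENNReal.ofReal (a / (2 ^ a - 1)) * (ENNReal.ofReal 2 *
        ∫⁻ x, ENNReal.ofReal (S (fun y => |f y|) x) ∂powMeasure a) := by
  rw [lintegral_const_mul_S_abs_powMeasure a zero_le_two hfloc,
    ← lintegral_const_mul' _ _ ENNReal.ofReal_ne_top]
  refine lintegral_mono fun s => ?_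
  rw [distFn_S_abs]
  exact volume_rpow_le_powMeasure ha inter_subset_left fun x hx t ht =>
    lt_of_lt_of_le hx.2 (S_abs_le_two_mul hfloc hx.1 ht)

lemma lintegral_S_abs_powMeasure_le {a : ℝ} (ha : 0 < a) (ha1 : a < 1)
    (hfloc : ∀ x > (0 : ℝ), IntegrableOn f (Ioo 0 x)) :
    ∫⁻ x, ENNReal.ofReal (S (fun y => |f y|) x) ∂powMeasure a ≤
      ENNReal.ofReal (1 / a + 1) *
        ∫⁻ s in Ioi (0 : ℝ), distFn (S fun y => |f y|) s ^ a := by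
  have hlayer := lintegral_const_mul_S_abs_powMeasure a zero_le_one hfloc
  simp only [ENNReal.ofReal_one, one_mul] at hlayer
  rw [hlayer, ← lintegral_const_mul' _ _ ENNReal.ofReal_ne_top]
  refine lintegral_mono fun s => ?_
  rw [distFn_S_abs, ← powMeasure_inter_Ioi]
  exact powMeasure_le_volume_rpow ha ha1
    (measurableSet_Ioi.inter (measurableSet_lt measurable_const (measurable_S_abs hfloc)))
    inter_subset_left

end Hardy

/-- For `1 < p < ∞` and `p' = p/(p-1)`, a measurable locally integrable `f` satisfies
`S|f| ∈ L^{p,1}(0,∞)` (i.e. `∫₀^∞ λ_{S|f|}(s)^{1/p} ds < ∞`) iff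
`∫₀^∞ |f(t)|·t^{-1/p'} dt < ∞`: the optimal domain `[S, L^{p,1}]` is `L¹(t^{-1/p'} dt)`. -/
theorem hardy_domain_Lp1 (p p' : ℝ) (hp : 1 < p) (hp' : p' = p / (p - 1))
    (f : ℝ → ℝ) (hfmeas : Measurable f)
    (hfloc : ∀ x > (0 : ℝ), IntegrableOn f (Ioo 0 x)) :
    (∫⁻ s in Ioi (0 : ℝ),
        (distFn (fun x => S (fun y => |f y|) x) s) ^ (1 / p)) < ⊤ ↔
      (∫⁻ t in Ioi (0 : ℝ), ENNReal.ofReal (|f t| * t ^ (-(1 / p')))) < ⊤ := by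
  have hp0 : 0 < p := by linarith
  have ha : 0 < 1 / p := by positivity
  have ha1 : 1 / p < 1 := (div_lt_one hp0).2 hp
  have hexp : -(1 / p') = 1 / p - 1 := by
    rw [hp', one_div_div]
    field_simp
    ring
  have hfubini := lintegral_S_abs_powMeasure ha1 hfmeas hfloc
  rw [hexp]
  constructor
  · intro h
    have hfin := (lintegral_S_abs_powMeasure_le ha ha1 hfloc).trans_lt
      (ENNReal.mul_lt_top ENNReal.ofReal_lt_top h)
    rw [hfubini] at hfin
    refine ENNReal.lt_top_of_mul_ne_top_right hfin.ne ?_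
    simpa using ha1
  · intro h
    refine (lintegral_distFn_S_abs_le ha hfloc).trans_lt ?_
    rw [hfubini]
    exact ENNReal.mul_lt_top ENNReal.ofReal_lt_top (ENNReal.mul_lt_top ENNReal.ofReal_lt_top
      (ENNReal.mul_lt_top ENNReal.ofReal_lt_top h))
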